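/- If u, v, w are orthonormal vectors in the octonions ℝ⁸, then |u×v×w| = 1, so that ⟨u, v, w, u×v×w⟩ is an orthonormal 4-frame (a Cayley frame). -/

import Mathlib

noncomputable section

/-- The octonions `𝕆 ≅ ℝ⁸`, realized as pairs of quaternions via Cayley–Dickson. -/
abbrev Octonion : Type := Quaternion ℝ × Quaternion ℝ

/-- Octonion multiplication (Cayley–Dickson doubling of the quaternions). -/
def omul (p q : Octonion) : Octonion :=
  (p.1 * q.1 - star q.2 * p.2, q.2 * p.1 + p.2 * star q.1)

/-- Octonion conjugation. -/
def oconj (p : Octonion) : Octonion := (star p.1, -p.2)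

/-- The standard inner product on the octonions `≅ ℝ⁸`. -/
def oinner (p q : Octonion) : ℝ := (p.1 * star q.1).re + (p.2 * star q.2).re

/-- The triple cross product `u×v×w = ½(u(v̄w) − w(v̄u))`. -/
def tcross (u v w : Octonion) : Octonion :=
  (2 : ℝ)⁻¹ • (omul u (omul (oconj v) w) - omul w (omul (oconj v) u))

/-- The Cayley 4-form `Ψ(u,v,w,z) = ⟨u×v×w, z⟩`. -/
def cayleyΨ (u v w z : Octonion) : ℝ := oinner (tcross u v w) z

theorem oinner_omul_self (p q : Octonion) :
    oinner (omul p q) (omul p q) = oinner p p * oinner q q := by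
  simp [oinner, omul]
  ring

theorem oinner_oconj_self (p : Octonion) : oinner (oconj p) (oconj p) = oinner p p := by
  simp [oinner, oconj]

theorem oinner_neg_left (p q : Octonion) : oinner (-p) q = -oinner p q := by
  simp [oinner]
  ring

theorem omul_neg (p q : Octonion) : omul p (-q) = -omul p q := by
  ext <;> simp [omul] <;> ring

theorem oinner_omul_left (p q : Octonion) : oinner (omul p q) p = oinner p p * q.1.re := by
  simp [oinner, omul]
  ring

theorem omul_oconj_fst_re (p q : Octonion) : (omul (oconj p) q).1.re = oinner p q := by
  simp [oinner, omul, oconj]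
  ring

theorem omul_oconj_swap {p q : Octonion} (h : oinner p q = 0) :
    omul (oconj p) q = -omul (oconj q) p := by
  simp [oinner] at h
  ext <;> simp [omul, oconj] <;> linarith

set_option maxHeartbeats 1000000 in
/-- The linearization of `p (p̄ r) = |p|² r`. -/
theorem omul_omul_oconj_add (p q r : Octonion) :
    omul p (omul (oconj q) r) + omul q (omul (oconj p) r) = (2 * oinner p q) • r := by
  ext <;> simp [omul, oconj, oinner] <;> ring

theorem omul_omul_oconj_swap {p q : Octonion} (h : oinner p q = 0) (r : Octonion) :
    omul p (omul (oconj q) r) = -omul q (omul (oconj p) r) := by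
  rw [eq_neg_iff_add_eq_zero, omul_omul_oconj_add, h, mul_zero, zero_smul]

/-- For `w` orthogonal to `u` and `v`, the product `u (v̄ w)` is invariant under rotation. -/
theorem omul_omul_oconj_rotate {u v w : Octonion} (huw : oinner u w = 0) (hvw : oinner v w = 0) :
    omul u (omul (oconj v) w) = omul w (omul (oconj u) v) := by
  rw [omul_oconj_swap hvw, omul_neg, omul_omul_oconj_swap huw, neg_neg]

theorem tcross_eq_omul {u v w : Octonion}
    (huv : oinner u v = 0) (huw : oinner u w = 0) (hvw : oinner v w = 0) :
    tcross u v w = omul u (omul (oconj v) w) := by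
  have h : omul w (omul (oconj v) u) = -omul u (omul (oconj v) w) := by
    rw [omul_omul_oconj_rotate huw hvw, omul_oconj_swap huv, omul_neg, neg_neg]
  rw [tcross, h, sub_neg_eq_add, ← two_smul ℝ, inv_smul_smul₀ two_ne_zero]

/-- if `u, v, w` are orthonormal then `|u×v×w| = 1`, so that
`⟨u, v, w, u×v×w⟩` is an orthonormal 4-frame (a Cayley frame). -/
theorem tcross_of_orthonormal_is_unit (u v w : Octonion)
    (hu : oinner u u = 1) (hv : oinner v v = 1) (hw : oinner w w = 1)
    (huv : oinner u v = 0) (huw : oinner u w = 0) (hvw : oinner v w = 0) :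
    oinner (tcross u v w) (tcross u v w) = 1 ∧
      oinner (tcross u v w) u = 0 ∧ oinner (tcross u v w) v = 0 ∧
        oinner (tcross u v w) w = 0 := by
  rw [tcross_eq_omul huv huw hvw]
  refine ⟨?_, ?_, ?_, ?_⟩
  · rw [oinner_omul_self, oinner_omul_self, oinner_oconj_self, hu, hv, hw, one_mul, one_mul]
  · rw [oinner_omul_left, omul_oconj_fst_re, hvw, mul_zero]
  · rw [omul_omul_oconj_swap huv, oinner_neg_left, oinner_omul_left, omul_oconj_fst_re, huw,
      mul_zero, neg_zero]
  · rw [omul_omul_oconj_rotate huw hvw, oinner_omul_left, omul_oconj_fst_re, huv, mul_zero]
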